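/- Let n ≥ 1, let A be the polynomial ring over ℚ in indeterminates a₂, …, a_{n+1} (with a₀ = 1, a₁ = 0), let f = x^{n+1} + Σ_{j=2}^{n+1} a_j x^{n+1−j} ∈ A[x], let B = A[x]/(f), free over A with basis 1, x, …, x^n, let π_! : B → A take the coefficient of x^n in this basis, and let 𝔞 = (a₂, …, a_{n+1}) ⊆ A. Set p₁^{fw} = (n+1)x² − 2a₂ and e^{fw} = Σ_{j=0}^{n} (n+1−j)·a_j·x^{n−j} in B. Then: π_!(e^{fw}) = n+1; π_!(e^{fw}·p₁^{fw}) = −4(n+1)·a₂; for every ℓ with 4 ≤ 2ℓ ≤ n+1, π_!(e^{fw}·(p₁^{fw})^ℓ) + 2ℓ(n+1)^ℓ·a_{2ℓ} ∈ 𝔞²; for every ℓ with 2 < 2ℓ−n ≤ n+1, π_!((p₁^{fw})^ℓ) + (n+1)^ℓ·a_{2ℓ−n} ∈ 𝔞²; and if 2ℓ−n = 2, then π_!((p₁^{fw})^ℓ) = −(2n+3)(n+1)^{ℓ−1}·a₂. -/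

import Mathlib

/-!
Statement 7: congruences for the tautological classes κ_e, κ_{ep₁^ℓ}, κ_{p₁^ℓ}.
A = ℚ[a₂,…,a_{n+1}], B = A[x]/(x^{n+1} + a₂x^{n−1} + ⋯ + a_{n+1}),
π_! the coefficient of x^n, 𝔞 = (a₂,…,a_{n+1}),
p₁^{fw} = (n+1)x² − 2a₂ and e^{fw} = Σ_{j=0}^{n} (n+1−j)·a_j·x^{n−j}.
-/

noncomputable section

open Polynomial

/-- The polynomial ring A = ℚ[a₂,…,a_{n+1}]. -/
abbrev ARing (n : ℕ) : Type := MvPolynomial {j : ℕ // 2 ≤ j ∧ j ≤ n + 1} ℚ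

/-- The element a_j, with conventions a₀ = 1, a₁ = 0 (and a_j = 0 for j > n+1). -/
def aGen (n : ℕ) (j : ℕ) : ARing n :=
  if j = 0 then 1 else if h : 2 ≤ j ∧ j ≤ n + 1 then MvPolynomial.X ⟨j, h⟩ else 0

/-- The monic polynomial f = x^{n+1} + Σ_{j=2}^{n+1} a_j x^{n+1−j}. -/
def fPoly (n : ℕ) : Polynomial (ARing n) :=
  X ^ (n + 1) + ∑ j ∈ Finset.Icc 2 (n + 1), C (aGen n j) * X ^ (n + 1 - j)

/-- π_! : B = A[x]/(f) → A, extracting the coefficient of x^n in the basis 1, x, …, x^n;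
computed on the canonical representative modulo the monic f. -/
def piShriek (n : ℕ) (g : Polynomial (ARing n)) : ARing n := (g %ₘ fPoly n).coeff n

/-- The ideal 𝔞 = (a₂,…,a_{n+1}) ⊆ A. -/
def aIdeal (n : ℕ) : Ideal (ARing n) :=
  Ideal.span {x : ARing n | ∃ j : ℕ, 2 ≤ j ∧ j ≤ n + 1 ∧ x = aGen n j}

/-- The fiberwise first Pontryagin class p₁^{fw} = (n+1)x² − 2a₂. -/
def p1fw (n : ℕ) : Polynomial (ARing n) :=
  C (((n + 1 : ℕ) : ARing n)) * X ^ 2 - C (2 * aGen n 2)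

/-- The fiberwise Euler class e^{fw} = Σ_{j=0}^{n} (n+1−j)·a_j·x^{n−j}. -/
def efw (n : ℕ) : Polynomial (ARing n) :=
  ∑ j ∈ Finset.range (n + 1), C (((n + 1 - j : ℕ) : ARing n) * aGen n j) * X ^ (n - j)

theorem aGen_zero (n : ℕ) : aGen n 0 = 1 := by simp [aGen]

theorem aGen_one (n : ℕ) : aGen n 1 = 0 := by simp [aGen]

theorem aGen_mem_aIdeal (n : ℕ) {j : ℕ} (hj : 1 ≤ j) : aGen n j ∈ aIdeal n := by
  by_cases h : 2 ≤ j ∧ j ≤ n + 1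
  · exact Ideal.subset_span ⟨j, h.1, h.2, rfl⟩
  · have : aGen n j = 0 := by simp [aGen, h, show j ≠ 0 by omega]
    simp [this]

theorem degree_fPoly_tail_lt (n : ℕ) :
    (∑ j ∈ Finset.Icc 2 (n + 1), C (aGen n j) * X ^ (n + 1 - j)).degree <
      ((n + 1 : ℕ) : WithBot ℕ) := by
  rw [← mem_degreeLT]
  refine Submodule.sum_mem _ fun j hj => ?_
  rw [Finset.mem_Icc] at hj
  rw [mem_degreeLT]
  refine (degree_C_mul_X_pow_le _ _).trans_lt ?_
  exact_mod_cast (show n + 1 - j < n + 1 by omega)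

theorem monic_fPoly (n : ℕ) : (fPoly n).Monic :=
  monic_X_pow_add (degree_fPoly_tail_lt n)

theorem degree_fPoly (n : ℕ) : (fPoly n).degree = ((n + 1 : ℕ) : WithBot ℕ) := by
  rw [fPoly, degree_add_eq_left_of_degree_lt, degree_X_pow]
  rw [degree_X_pow]
  exact degree_fPoly_tail_lt n

/-- Integration along the fiber as an `A`-linear map on `A[x]`. -/
def piShriekLinear (n : ℕ) : (ARing n)[X] →ₗ[ARing n] ARing n :=
  lcoeff (ARing n) n ∘ₗ modByMonicHom (fPoly n)

theorem piShriek_add (n : ℕ) (g h : (ARing n)[X]) :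
    piShriek n (g + h) = piShriek n g + piShriek n h :=
  map_add (piShriekLinear n) g h

theorem piShriek_sum (n : ℕ) {ι : Type*} (s : Finset ι) (g : ι → (ARing n)[X]) :
    piShriek n (∑ i ∈ s, g i) = ∑ i ∈ s, piShriek n (g i) :=
  map_sum (piShriekLinear n) g s

theorem piShriek_C_mul (n : ℕ) (a : ARing n) (g : (ARing n)[X]) :
    piShriek n (C a * g) = a * piShriek n g := by
  rw [← smul_eq_C_mul]
  exact map_smul (piShriekLinear n) a g

theorem piShriek_mul_fPoly (n : ℕ) (g : (ARing n)[X]) : piShriek n (g * fPoly n) = 0 := by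
  rw [piShriek, (modByMonic_eq_zero_iff_dvd (monic_fPoly n)).2 (dvd_mul_left _ _), coeff_zero]

theorem piShriek_X_pow_of_le (n : ℕ) {m : ℕ} (hm : m ≤ n) :
    piShriek n (X ^ m) = if n = m then 1 else 0 := by
  rw [piShriek, (modByMonic_eq_self_iff (monic_fPoly n)).2, coeff_X_pow]
  rw [degree_fPoly, degree_X_pow]
  exact_mod_cast Nat.lt_succ_of_le hm

theorem piShriek_X_pow_of_lt (n : ℕ) {m : ℕ} (hm : m < n) : piShriek n (X ^ m) = 0 := by
  rw [piShriek_X_pow_of_le n hm.le, if_neg hm.ne']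

theorem piShriek_X_pow_self (n : ℕ) : piShriek n (X ^ n) = 1 := by
  simp [piShriek_X_pow_of_le n le_rfl]

theorem piShriek_X_pow_recurrence (n : ℕ) {m : ℕ} (hm : n + 1 ≤ m) :
    piShriek n (X ^ m) =
      -∑ j ∈ Finset.Icc 2 (n + 1), aGen n j * piShriek n (X ^ (m - j)) := by
  have h := piShriek_mul_fPoly n (X ^ (m - (n + 1)))
  rw [fPoly, mul_add, Finset.mul_sum, piShriek_add, ← pow_add, Nat.sub_add_cancel hm,
    piShriek_sum] at h
  rw [eq_neg_of_add_eq_zero_left h]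
  congr 1
  refine Finset.sum_congr rfl fun j hj => ?_
  rw [Finset.mem_Icc] at hj
  rw [mul_left_comm, piShriek_C_mul, ← pow_add]
  congr 4
  omega

theorem piShriek_X_pow_add_two (n : ℕ) (hn : 1 ≤ n) : piShriek n (X ^ (n + 2)) = -aGen n 2 := by
  rw [piShriek_X_pow_recurrence n (by omega), Finset.sum_eq_single 2]
  · simp [piShriek_X_pow_self]
  · intro j hj hj2
    rw [Finset.mem_Icc] at hj
    rw [piShriek_X_pow_of_lt n (by omega), mul_zero]
  · intro h
    exact absurd (Finset.mem_Icc.2 ⟨le_rfl, by omega⟩) h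

theorem piShriek_X_pow_mem_aIdeal (n : ℕ) {m : ℕ} (hm : n < m) :
    piShriek n (X ^ m) ∈ aIdeal n := by
  rw [piShriek_X_pow_recurrence n hm]
  refine neg_mem (Ideal.sum_mem _ fun j hj => Ideal.mul_mem_right _ _ ?_)
  exact aGen_mem_aIdeal n (by rw [Finset.mem_Icc] at hj; omega)

theorem Ideal.sum_sub_single_mem {R ι : Type*} [CommRing R] (I : Ideal R) {s : Finset ι} {i : ι}
    (g : ι → R) (hi : i ∈ s) (h : ∀ j ∈ s, j ≠ i → g j ∈ I) : ∑ j ∈ s, g j - g i ∈ I := by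
  classical
  rw [← Finset.add_sum_erase s g hi, add_sub_cancel_left]
  exact Ideal.sum_mem _ fun j hj => h j (Finset.mem_of_mem_erase hj) (Finset.ne_of_mem_erase hj)

theorem aGen_mul_piShriek_X_pow_mem (n : ℕ) {j k : ℕ} (hj : 1 ≤ j) (hjn : j ≤ n + k)
    (hjk : j ≠ k) : aGen n j * piShriek n (X ^ (n + k - j)) ∈ aIdeal n ^ 2 := by
  rcases lt_or_gt_of_ne hjk with h | h
  · rw [pow_two]
    exact Ideal.mul_mem_mul (aGen_mem_aIdeal n hj) (piShriek_X_pow_mem_aIdeal n (by omega))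
  · rw [piShriek_X_pow_of_lt n (by omega), mul_zero]
    exact zero_mem _

theorem piShriek_X_pow_add_aGen_mem (n : ℕ) {k : ℕ} (hk : 2 ≤ k) (hkn : k ≤ n + 1) :
    piShriek n (X ^ (n + k)) + aGen n k ∈ aIdeal n ^ 2 := by
  have h := Ideal.sum_sub_single_mem (aIdeal n ^ 2)
    (fun j => aGen n j * piShriek n (X ^ (n + k - j))) (Finset.mem_Icc.2 ⟨hk, hkn⟩)
    fun j hj hjk => by
      rw [Finset.mem_Icc] at hj
      exact aGen_mul_piShriek_X_pow_mem n (by omega) (by omega) hjk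
  rw [piShriek_X_pow_recurrence n (by omega)]
  simp only [Nat.add_sub_cancel, piShriek_X_pow_self, mul_one] at h
  convert neg_mem h using 1
  ring

theorem piShriek_efw_mul_X_pow (n m : ℕ) :
    piShriek n (efw n * X ^ m) = ((n + 1 : ℕ) : ARing n) * piShriek n (X ^ (n + m)) +
      ∑ j ∈ Finset.Icc 1 (n + 1),
        ((n + 1 - j : ℕ) : ARing n) * (aGen n j * piShriek n (X ^ (n + m - j))) := by
  have h : ∀ j ∈ Finset.range (n + 1),
      piShriek n (C (((n + 1 - j : ℕ) : ARing n) * aGen n j) * X ^ (n - j) * X ^ m) =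
        ((n + 1 - j : ℕ) : ARing n) * (aGen n j * piShriek n (X ^ (n + m - j))) := by
    intro j hj
    rw [Finset.mem_range] at hj
    rw [mul_assoc, piShriek_C_mul, ← pow_add, mul_assoc, show n - j + m = n + m - j by omega]
  rw [efw, Finset.sum_mul, piShriek_sum, Finset.sum_congr rfl h,
    Finset.range_eq_Ico, Finset.sum_eq_sum_Ico_succ_bot (Nat.succ_pos n)]
  simp only [Nat.sub_zero, aGen_zero, one_mul, zero_add]
  rw [← Finset.Ico_insert_right (Nat.le_add_left 1 n), Finset.sum_insert Finset.right_notMem_Ico]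
  simp

theorem piShriek_efw (n : ℕ) : piShriek n (efw n) = ((n + 1 : ℕ) : ARing n) := by
  have h := piShriek_efw_mul_X_pow n 0
  rw [pow_zero, mul_one] at h
  rw [h, add_zero, piShriek_X_pow_self, mul_one, add_eq_left]
  refine Finset.sum_eq_zero fun j hj => ?_
  rw [Finset.mem_Icc] at hj
  rcases Nat.eq_zero_or_pos n with rfl | hn
  · simp [show j = 1 by omega]
  · rw [piShriek_X_pow_of_lt n (by omega), mul_zero, mul_zero]

theorem piShriek_efw_mul_X_sq (n : ℕ) (hn : 1 ≤ n) :
    piShriek n (efw n * X ^ 2) = -(2 * aGen n 2) := by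
  rw [piShriek_efw_mul_X_pow, piShriek_X_pow_add_two n hn, Finset.sum_eq_single 2]
  · obtain ⟨k, rfl⟩ := Nat.exists_eq_add_of_le' hn
    simp only [Nat.add_sub_cancel, piShriek_X_pow_self, Nat.reduceSubDiff]
    push_cast
    ring
  · intro j hj hj2
    rw [Finset.mem_Icc] at hj
    rcases Nat.lt_or_gt_of_ne hj2 with h | h
    · rw [show j = 1 by omega, aGen_one, zero_mul, mul_zero]
    · rw [piShriek_X_pow_of_lt n (by omega), mul_zero, mul_zero]
  · intro h
    exact absurd (Finset.mem_Icc.2 ⟨one_le_two, by omega⟩) h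

theorem piShriek_efw_mul_X_pow_add_mem (n : ℕ) {m : ℕ} (hm : 2 ≤ m) (hmn : m ≤ n + 1) :
    piShriek n (efw n * X ^ m) + (m : ARing n) * aGen n m ∈ aIdeal n ^ 2 := by
  have h := Ideal.sum_sub_single_mem (aIdeal n ^ 2)
    (fun j => ((n + 1 - j : ℕ) : ARing n) * (aGen n j * piShriek n (X ^ (n + m - j))))
    (Finset.mem_Icc.2 ⟨by omega, hmn⟩ : m ∈ Finset.Icc 1 (n + 1))
    fun j hj hjm => by
      rw [Finset.mem_Icc] at hj
      exact Ideal.mul_mem_left _ _ (aGen_mul_piShriek_X_pow_mem n hj.1 (by omega) hjm)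
  simp only [Nat.add_sub_cancel, piShriek_X_pow_self, mul_one] at h
  rw [piShriek_efw_mul_X_pow]
  convert add_mem h (Ideal.mul_mem_left _ ((n + 1 : ℕ) : ARing n)
    (piShriek_X_pow_add_aGen_mem n hm hmn)) using 1
  rw [Nat.cast_sub hmn]
  ring

theorem piShriek_efw_mul_X_pow_mem_aIdeal (n : ℕ) {m : ℕ} (hm : 1 ≤ m) :
    piShriek n (efw n * X ^ m) ∈ aIdeal n := by
  rw [piShriek_efw_mul_X_pow]
  refine add_mem (Ideal.mul_mem_left _ _ (piShriek_X_pow_mem_aIdeal n (by omega)))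
    (Ideal.sum_mem _ fun j hj => Ideal.mul_mem_left _ _ (Ideal.mul_mem_right _ _ ?_))
  exact aGen_mem_aIdeal n (Finset.mem_Icc.1 hj).1

theorem p1fw_eq_add (n : ℕ) :
    p1fw n = C ((n + 1 : ℕ) : ARing n) * X ^ 2 + C (-(2 * aGen n 2)) := by
  rw [p1fw, C_neg, sub_eq_add_neg]

/-- Modulo `𝔞²` only the leading term of `(p₁^{fw})^l` contributes to `π_! (g * (p₁^{fw})^l)`,
provided that the second term already integrates into `𝔞`. -/
theorem piShriek_mul_p1fw_pow_sub_mem (n l : ℕ) (g : (ARing n)[X])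
    (h : piShriek n (g * X ^ (2 * (l - 1))) ∈ aIdeal n) :
    piShriek n (g * p1fw n ^ l) - ((n + 1 : ℕ) : ARing n) ^ l * piShriek n (g * X ^ (2 * l)) ∈
      aIdeal n ^ 2 := by
  obtain ⟨r, hr⟩ := powAddExpansion (C ((n + 1 : ℕ) : ARing n) * X ^ 2) (C (-(2 * aGen n 2))) l
  have hb : -(2 * aGen n 2) ∈ aIdeal n :=
    neg_mem (Ideal.mul_mem_left _ _ (aGen_mem_aIdeal n one_le_two))
  have hexp : g * p1fw n ^ l =
      C (((n + 1 : ℕ) : ARing n) ^ l) * (g * X ^ (2 * l)) +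
      C ((l : ARing n) * ((n + 1 : ℕ) : ARing n) ^ (l - 1) * -(2 * aGen n 2)) *
        (g * X ^ (2 * (l - 1))) + C ((-(2 * aGen n 2)) ^ 2) * (g * r) := by
    rw [p1fw_eq_add, hr]
    simp only [C_mul, C_pow, mul_pow, pow_mul, map_natCast]
    ring
  rw [hexp, piShriek_add, piShriek_add, piShriek_C_mul, piShriek_C_mul, piShriek_C_mul, add_assoc,
    add_sub_cancel_left]
  refine add_mem ?_ (Ideal.mul_mem_right _ _ (Ideal.pow_mem_pow hb 2))
  rw [mul_assoc, pow_two]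
  exact Ideal.mul_mem_left _ _ (Ideal.mul_mem_mul hb h)

theorem piShriek_efw_mul_p1fw (n : ℕ) (hn : 1 ≤ n) :
    piShriek n (efw n * p1fw n) = -(4 * ((n + 1 : ℕ) : ARing n) * aGen n 2) := by
  rw [p1fw_eq_add, mul_add, mul_left_comm, mul_comm (efw n) (C _), piShriek_add, piShriek_C_mul,
    piShriek_C_mul, piShriek_efw_mul_X_sq n hn, piShriek_efw]
  ring

theorem piShriek_efw_mul_p1fw_pow_add_mem (n : ℕ) {l : ℕ} (hl : 4 ≤ 2 * l)
    (hln : 2 * l ≤ n + 1) :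
    piShriek n (efw n * p1fw n ^ l) +
      ((2 * l : ℕ) : ARing n) * ((n + 1 : ℕ) : ARing n) ^ l * aGen n (2 * l) ∈ aIdeal n ^ 2 := by
  convert add_mem
    (piShriek_mul_p1fw_pow_sub_mem n l (efw n) (piShriek_efw_mul_X_pow_mem_aIdeal n (by omega)))
    (Ideal.mul_mem_left _ (((n + 1 : ℕ) : ARing n) ^ l)
      (piShriek_efw_mul_X_pow_add_mem n (by omega : 2 ≤ 2 * l) hln)) using 1
  ring

theorem piShriek_p1fw_pow_add_mem (n : ℕ) {l : ℕ} (hl : 2 < 2 * l - n)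
    (hln : 2 * l - n ≤ n + 1) :
    piShriek n (p1fw n ^ l) + ((n + 1 : ℕ) : ARing n) ^ l * aGen n (2 * l - n) ∈
      aIdeal n ^ 2 := by
  have h₁ := piShriek_mul_p1fw_pow_sub_mem n l 1
    (by rw [one_mul]; exact piShriek_X_pow_mem_aIdeal n (by omega))
  have h₂ := piShriek_X_pow_add_aGen_mem n hl.le hln
  rw [one_mul, one_mul] at h₁
  rw [show n + (2 * l - n) = 2 * l by omega] at h₂
  convert add_mem h₁ (Ideal.mul_mem_left _ (((n + 1 : ℕ) : ARing n) ^ l) h₂) using 1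
  ring

theorem piShriek_p1fw_pow_eq (n : ℕ) (hn : 1 ≤ n) {l : ℕ} (hl : 2 * l - n = 2) :
    piShriek n (p1fw n ^ l) =
      -(((2 * n + 3 : ℕ) : ARing n) * ((n + 1 : ℕ) : ARing n) ^ (l - 1) * aGen n 2) := by
  obtain ⟨k, rfl⟩ : ∃ k, l = k + 1 := ⟨l - 1, by omega⟩
  obtain rfl : n = 2 * k := by omega
  set c : ARing (2 * k) := ((2 * k + 1 : ℕ) : ARing (2 * k)) with hc
  set b : ARing (2 * k) := -(2 * aGen (2 * k) 2) with hb
  have hterm : ∀ i, piShriek (2 * k) ((C c * X ^ 2) ^ i * C b ^ (k + 1 - i) *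
      ((k + 1).choose i : (ARing (2 * k))[X])) =
      c ^ i * b ^ (k + 1 - i) * ((k + 1).choose i : ARing (2 * k)) *
        piShriek (2 * k) (X ^ (2 * i)) := by
    intro i
    rw [← piShriek_C_mul]
    congr 1
    simp only [C_mul, C_pow, mul_pow, pow_mul, map_natCast]
    ring
  rw [p1fw_eq_add, add_pow, piShriek_sum, Finset.sum_congr rfl fun i _ => hterm i,
    Finset.sum_range_succ, Finset.sum_range_succ, Finset.sum_eq_zero]
  · rw [piShriek_X_pow_self, mul_add, mul_one, piShriek_X_pow_add_two _ hn]
    simp only [Nat.choose_self, Nat.choose_succ_self_right, Nat.sub_self, Nat.add_sub_cancel,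
      Nat.add_sub_cancel_left, hb, hc]
    push_cast
    ring
  · intro i hi
    rw [Finset.mem_range] at hi
    rw [piShriek_X_pow_of_lt _ (by omega), mul_zero]

theorem stmt7 (n : ℕ) (hn : 1 ≤ n) :
    piShriek n (efw n) = ((n + 1 : ℕ) : ARing n) ∧
    piShriek n (efw n * p1fw n) = -(4 * ((n + 1 : ℕ) : ARing n) * aGen n 2) ∧
    (∀ l : ℕ, 4 ≤ 2 * l → 2 * l ≤ n + 1 →
      piShriek n (efw n * p1fw n ^ l) +
        ((2 * l : ℕ) : ARing n) * ((n + 1 : ℕ) : ARing n) ^ l * aGen n (2 * l) ∈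
          aIdeal n ^ 2) ∧
    (∀ l : ℕ, 2 < 2 * l - n → 2 * l - n ≤ n + 1 →
      piShriek n (p1fw n ^ l) +
        ((n + 1 : ℕ) : ARing n) ^ l * aGen n (2 * l - n) ∈ aIdeal n ^ 2) ∧
    (∀ l : ℕ, 2 * l - n = 2 →
      piShriek n (p1fw n ^ l) =
        -(((2 * n + 3 : ℕ) : ARing n) * ((n + 1 : ℕ) : ARing n) ^ (l - 1) * aGen n 2)) := by
  exact ⟨piShriek_efw n, piShriek_efw_mul_p1fw n hn,
    fun _ => piShriek_efw_mul_p1fw_pow_add_mem n, fun _ => piShriek_p1fw_pow_add_mem n,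
    fun _ => piShriek_p1fw_pow_eq n hn⟩

end
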